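/- arXiv:1307.4829 — 2 statements merged into one kernel-verified Lean document; each statement's English description precedes it below -/
import Mathlib

section
/- Let 0 < p < ∞ and α ∈ ℝ. The norms ‖f‖_{F^p_α} = (∫ |f(z)e^{-|z|²/2}|^p (1+|z|)^{-α} dv(z))^{1/p} and the modified norm using the weight |z|^{-α} (splitting f into its Taylor polynomial of degree ≤ α/p with unweighted Gaussian measure and the tail with the |z|^{-α}-weighted Gaussian measure when α > 0; or simply using |z|^{-α} throughout when α ≤ 0) are equivalent on the space F^p_α of entire functions with finite ‖·‖_{F^p_α}. -/
open MeasureTheory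

noncomputable instance (n : ℕ) : MeasurableSpace (EuclideanSpace ℂ (Fin n)) := borel _
instance (n : ℕ) : BorelSpace (EuclideanSpace ℂ (Fin n)) := ⟨rfl⟩

section

variable {n : ℕ}

/-- `log ‖F ·‖` satisfies the sub-mean-value inequality. -/
lemma log_norm_le_circleAverage {F : ℂ → ℂ} (hF : Differentiable ℂ F) (h0 : F 0 ≠ 0) :
    Real.log ‖F 0‖ ≤ Real.circleAverage (fun z => Real.log ‖F z‖) 0 1 := by
  have hA : AnalyticOnNhd ℂ F (Metric.closedBall 0 |1|) := fun z _ => hF.analyticAt z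
  rw [hA.circleAverage_log_norm one_ne_zero h0]
  refine le_add_of_nonneg_left (finsum_nonneg fun u => ?_)
  by_cases hu : u ∈ Metric.closedBall (0 : ℂ) |1|
  · have hd : 0 ≤ MeromorphicOn.divisor F (Metric.closedBall 0 |1|) u :=
      MeromorphicOn.AnalyticOnNhd.divisor_nonneg hA u
    refine mul_nonneg (by exact_mod_cast hd) ?_
    rcases eq_or_ne u 0 with rfl | hne
    · simp
    · refine Real.log_nonneg ?_
      have : ‖u‖ ≤ 1 := by simpa using hu
      rw [one_mul, zero_sub, norm_neg]
      exact (one_le_inv₀ (norm_pos_iff.2 hne)).2 this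
  · simp [Function.locallyFinsuppWithin.apply_eq_zero_of_notMem _ hu]

/-- Tangent line inequality for `t ↦ t ^ p` in logarithmic coordinates. -/
lemma rpow_mul_one_add_log_le {a t p : ℝ} (ha : 0 < a) (ht : 0 < t) :
    a ^ p * (1 + p * (Real.log t - Real.log a)) ≤ t ^ p := by
  have h := Real.add_one_le_exp (p * (Real.log t - Real.log a))
  have e : t ^ p = a ^ p * Real.exp (p * (Real.log t - Real.log a)) := by
    rw [Real.rpow_def_of_pos ha, Real.rpow_def_of_pos ht, ← Real.exp_add]
    ring_nf
  rw [e]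
  gcongr
  linarith

lemma norm_rpow_le_circleAverage {F : ℂ → ℂ} (hF : Differentiable ℂ F) {p : ℝ} (hp : 0 < p) :
    ‖F 0‖ ^ p ≤ Real.circleAverage (fun z => ‖F z‖ ^ p) 0 1 := by
  by_cases h0 : F 0 = 0
  · rw [h0, norm_zero, Real.zero_rpow hp.ne']
    exact Real.circleAverage_nonneg_of_nonneg fun z _ => by positivity
  have ha : 0 < ‖F 0‖ := norm_pos_iff.2 h0
  have hcont : Continuous fun z => ‖F z‖ ^ p :=
    hF.continuous.norm.rpow_const fun _ => Or.inr hp.le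
  have hint : CircleIntegrable (fun z => Real.log ‖F z‖) 0 1 :=
    MeromorphicOn.circleIntegrable_log_norm fun z _ => (hF.analyticAt z).meromorphicAt
  set L : ℂ → ℝ := fun z => ‖F 0‖ ^ p * (1 + p * (Real.log ‖F z‖ - Real.log ‖F 0‖)) with hL
  have hLint : CircleIntegrable L 0 1 := by
    have h1 : CircleIntegrable (fun _ => (1 - p * Real.log ‖F 0‖) * ‖F 0‖ ^ p) 0 1 :=
      circleIntegrable_const _ _ _
    have h2 : CircleIntegrable (fun z => (‖F 0‖ ^ p * p) • Real.log ‖F z‖) 0 1 :=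
      hint.const_smul
    convert h1.add h2 using 1
    ext z
    simp [hL]
    ring
  have hLavg : Real.circleAverage L 0 1 =
      ‖F 0‖ ^ p * (1 + p * (Real.circleAverage (fun z => Real.log ‖F z‖) 0 1
        - Real.log ‖F 0‖)) := by
    have h1 : CircleIntegrable (fun _ => (1 - p * Real.log ‖F 0‖) * ‖F 0‖ ^ p) 0 1 :=
      circleIntegrable_const _ _ _
    have h2 : CircleIntegrable (fun z => (‖F 0‖ ^ p * p) • Real.log ‖F z‖) 0 1 :=
      hint.const_smul
    have e : L = (fun _ => (1 - p * Real.log ‖F 0‖) * ‖F 0‖ ^ p) +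
        fun z => (‖F 0‖ ^ p * p) • Real.log ‖F z‖ := by
      ext z
      simp [hL]
      ring
    rw [e, Real.circleAverage_add h1 h2, Real.circleAverage_const, Real.circleAverage_fun_smul,
      smul_eq_mul]
    ring
  have hne : ∀ᶠ z in Filter.codiscreteWithin (Metric.sphere (0 : ℂ) |1|), F z ≠ 0 := by
    have hA : AnalyticOnNhd ℂ F Set.univ := fun z _ => hF.analyticAt z
    have := hA.preimage_zero_mem_codiscrete h0
    exact Filter.codiscreteWithin_mono (Set.subset_univ _) this
  have hmin : (fun z => min (L z) (‖F z‖ ^ p))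
      =ᶠ[Filter.codiscreteWithin (Metric.sphere (0 : ℂ) |1|)] L := by
    filter_upwards [hne] with z hz
    exact min_eq_left (rpow_mul_one_add_log_le ha (norm_pos_iff.2 hz))
  calc ‖F 0‖ ^ p ≤ Real.circleAverage L 0 1 := by
        rw [hLavg]
        have := log_norm_le_circleAverage hF h0
        refine le_mul_of_one_le_right (by positivity) ?_
        have : 0 ≤ p * (Real.circleAverage (fun z => Real.log ‖F z‖) 0 1 - Real.log ‖F 0‖) :=
          mul_nonneg hp.le (by linarith)
        linarith
    _ = Real.circleAverage (fun z => min (L z) (‖F z‖ ^ p)) 0 1 :=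
        (Real.circleAverage_congr_codiscreteWithin hmin one_ne_zero).symm
    _ ≤ Real.circleAverage (fun z => ‖F z‖ ^ p) 0 1 := by
        refine Real.circleAverage_mono ?_ hcont.continuousOn.circleIntegrable'
          fun z _ => min_le_right _ _
        exact hLint.congr_codiscreteWithin hmin.symm

lemma ofReal_norm_rpow_le_lintegral {F : ℂ → ℂ} (hF : Differentiable ℂ F) {p : ℝ} (hp : 0 < p) :
    ENNReal.ofReal (2 * Real.pi) * ENNReal.ofReal (‖F 0‖ ^ p) ≤
      ∫⁻ θ in Set.Ioc 0 (2 * Real.pi), ENNReal.ofReal (‖F (circleMap 0 1 θ)‖ ^ p) := by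
  have hcont : Continuous fun θ => ‖F (circleMap 0 1 θ)‖ ^ p :=
    (hF.continuous.comp (continuous_circleMap 0 1)).norm.rpow_const fun _ => Or.inr hp.le
  have h := norm_rpow_le_circleAverage hF hp
  rw [Real.circleAverage_def, smul_eq_mul, intervalIntegral.integral_of_le (by positivity)] at h
  rw [← ofReal_integral_eq_lintegral_ofReal
    (hcont.integrableOn_Ioc) (Filter.Eventually.of_forall fun _ => by positivity),
    ← ENNReal.ofReal_mul (by positivity)]
  refine ENNReal.ofReal_le_ofReal ?_
  have hpi : 0 < 2 * Real.pi := by positivity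
  rwa [inv_mul_eq_div, le_div_iff₀' hpi] at h

/-- Multiplication by `e^{iθ}` preserves Lebesgue measure on `ℂⁿ`. -/
lemma measurePreserving_circleMap_smul (θ : ℝ) :
    MeasurePreserving (fun w : EuclideanSpace ℂ (Fin n) => circleMap 0 1 θ • w) := by
  have hne : circleMap 0 1 θ ≠ 0 := circleMap_ne_center one_ne_zero
  let e : EuclideanSpace ℂ (Fin n) ≃ₗᵢ[ℝ] EuclideanSpace ℂ (Fin n) :=
    { (LinearEquiv.smulOfNeZero ℂ (EuclideanSpace ℂ (Fin n)) _ hne).restrictScalars ℝ with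
      norm_map' := fun w => by
        change ‖circleMap 0 1 θ • w‖ = ‖w‖
        rw [norm_smul, norm_circleMap_zero, abs_one, one_mul] }
  exact e.measurePreserving

lemma ofReal_norm_rpow_mul_volume_le {f : EuclideanSpace ℂ (Fin n) → ℂ}
    (hf : Differentiable ℂ f) {p : ℝ} (hp : 0 < p) (z : EuclideanSpace ℂ (Fin n)) (a b : ℝ) :
    ENNReal.ofReal (‖f z‖ ^ p) * volume {w : EuclideanSpace ℂ (Fin n) | a ≤ ‖w‖ ∧ ‖w‖ ≤ b} ≤
      ∫⁻ w in {w : EuclideanSpace ℂ (Fin n) | a ≤ ‖w‖ ∧ ‖w‖ ≤ b},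
        ENNReal.ofReal (‖f (z + w)‖ ^ p) := by
  set A : Set (EuclideanSpace ℂ (Fin n)) := {w | a ≤ ‖w‖ ∧ ‖w‖ ≤ b} with hAdef
  have hA : MeasurableSet A :=
    ((isClosed_le continuous_const continuous_norm).inter
      (isClosed_le continuous_norm continuous_const)).measurableSet
  have hpi : ENNReal.ofReal (2 * Real.pi) ≠ 0 := by
    simpa using Real.pi_pos
  have hrot : ∀ θ : ℝ, ∫⁻ w in A, ENNReal.ofReal (‖f (z + circleMap 0 1 θ • w)‖ ^ p) =
      ∫⁻ w in A, ENNReal.ofReal (‖f (z + w)‖ ^ p) := by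
    intro θ
    have hm : Measurable fun w => ENNReal.ofReal (‖f (z + w)‖ ^ p) := by
      have := hf.continuous
      exact ENNReal.measurable_ofReal.comp
        (((by fun_prop : Continuous fun w => ‖f (z + w)‖).rpow_const
        fun _ => Or.inr hp.le).measurable)
    have hpre : (fun w : EuclideanSpace ℂ (Fin n) => circleMap 0 1 θ • w) ⁻¹' A = A := by
      ext w
      simp [hAdef, norm_smul]
    have := (measurePreserving_circleMap_smul (n := n) θ).setLIntegral_comp_preimage hA hm
    rwa [hpre] at this
  have hmain : ENNReal.ofReal (2 * Real.pi) * (ENNReal.ofReal (‖f z‖ ^ p) * volume A) ≤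
      ENNReal.ofReal (2 * Real.pi) * ∫⁻ w in A, ENNReal.ofReal (‖f (z + w)‖ ^ p) := by
    calc ENNReal.ofReal (2 * Real.pi) * (ENNReal.ofReal (‖f z‖ ^ p) * volume A)
        = ∫⁻ _ in A, ENNReal.ofReal (2 * Real.pi) * ENNReal.ofReal (‖f z‖ ^ p) := by
          rw [setLIntegral_const, mul_assoc]
      _ ≤ ∫⁻ w in A, ∫⁻ θ in Set.Ioc 0 (2 * Real.pi),
            ENNReal.ofReal (‖f (z + circleMap 0 1 θ • w)‖ ^ p) := by
          refine lintegral_mono fun w => ?_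
          have := ofReal_norm_rpow_le_lintegral (F := fun t : ℂ => f (z + t • w))
            (by fun_prop) hp
          simpa using this
      _ = ∫⁻ θ in Set.Ioc 0 (2 * Real.pi), ∫⁻ w in A,
            ENNReal.ofReal (‖f (z + circleMap 0 1 θ • w)‖ ^ p) := by
          refine lintegral_lintegral_swap ?_
          have := hf.continuous
          have hc := continuous_circleMap 0 1
          have : Continuous fun q : EuclideanSpace ℂ (Fin n) × ℝ =>
              ‖f (z + circleMap 0 1 q.2 • q.1)‖ := by fun_prop
          exact (ENNReal.continuous_ofReal.comp
            (this.rpow_const fun _ => Or.inr hp.le)).measurable.aemeasurable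
      _ = ENNReal.ofReal (2 * Real.pi) * ∫⁻ w in A, ENNReal.ofReal (‖f (z + w)‖ ^ p) := by
          simp_rw [hrot]
          rw [setLIntegral_const, Real.volume_Ioc, sub_zero, mul_comm]
  exact (ENNReal.mul_le_mul_iff_right hpi ENNReal.ofReal_ne_top).1 hmain

/-- On the ball of radius `2`, an entire function is controlled by its `p`-th powers integrated over
an annulus that stays away from the origin. -/
lemma exists_ofReal_norm_rpow_le_lintegral_annulus (hn : 1 ≤ n) {p : ℝ} (hp : 0 < p) :
    ∃ K : ENNReal, K ≠ ⊤ ∧ ∀ f : EuclideanSpace ℂ (Fin n) → ℂ, Differentiable ℂ f →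
      ∀ z, ‖z‖ ≤ 2 → ENNReal.ofReal (‖f z‖ ^ p) ≤
        K * ∫⁻ w in {w : EuclideanSpace ℂ (Fin n) | 1 ≤ ‖w‖ ∧ ‖w‖ ≤ 6},
          ENNReal.ofReal (‖f w‖ ^ p) := by
  have : Nonempty (Fin n) := ⟨⟨0, hn⟩⟩
  set A : Set (EuclideanSpace ℂ (Fin n)) := {w | 3 ≤ ‖w‖ ∧ ‖w‖ ≤ 4} with hAdef
  have hA0 : volume A ≠ 0 := by
    have ho : IsOpen {w : EuclideanSpace ℂ (Fin n) | 3 < ‖w‖ ∧ ‖w‖ < 4} :=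
      (isOpen_lt continuous_const continuous_norm).inter
        (isOpen_lt continuous_norm continuous_const)
    obtain ⟨x, hx⟩ := NormedSpace.exists_lt_norm ℂ (EuclideanSpace ℂ (Fin n)) 0
    have hne : {w : EuclideanSpace ℂ (Fin n) | 3 < ‖w‖ ∧ ‖w‖ < 4}.Nonempty := by
      refine ⟨((7 / 2 / ‖x‖ : ℝ) : ℂ) • x, ?_⟩
      have : ‖((7 / 2 / ‖x‖ : ℝ) : ℂ) • x‖ = 7 / 2 := by
        rw [norm_smul, Complex.norm_real, Real.norm_of_nonneg (by positivity)]
        field_simp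
      rw [Set.mem_ofPred_eq, this]
      norm_num
    have := ho.measure_pos volume hne
    exact (this.trans_le (measure_mono (t := A) fun w hw => ⟨hw.1.le, hw.2.le⟩)).ne'
  have hAtop : volume A ≠ ⊤ := by
    refine ((measure_mono (t := Metric.closedBall 0 4) fun w hw => ?_).trans_lt
      measure_closedBall_lt_top).ne
    simpa using hw.2
  refine ⟨(volume A)⁻¹, ENNReal.inv_ne_top.2 hA0, fun f hf z hz => ?_⟩
  have h1 := ofReal_norm_rpow_mul_volume_le hf hp z 3 4
  have h2 : ∫⁻ w in A, ENNReal.ofReal (‖f (z + w)‖ ^ p) ≤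
      ∫⁻ w in {w : EuclideanSpace ℂ (Fin n) | 1 ≤ ‖w‖ ∧ ‖w‖ ≤ 6},
          ENNReal.ofReal (‖f w‖ ^ p) := by
    have hB : MeasurableSet {w : EuclideanSpace ℂ (Fin n) | 1 ≤ ‖w‖ ∧ ‖w‖ ≤ 6} :=
      ((isClosed_le continuous_const continuous_norm).inter
        (isClosed_le continuous_norm continuous_const)).measurableSet
    have hA : MeasurableSet A :=
      ((isClosed_le continuous_const continuous_norm).inter
        (isClosed_le continuous_norm continuous_const)).measurableSet
    rw [← lintegral_indicator hA, ← lintegral_indicator hB,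
      ← lintegral_add_left_eq_self (μ := volume)
        ({w : EuclideanSpace ℂ (Fin n) | 1 ≤ ‖w‖ ∧ ‖w‖ ≤ 6}.indicator
          fun w => ENNReal.ofReal (‖f w‖ ^ p)) z]
    refine lintegral_mono fun w => ?_
    by_cases hw : w ∈ A
    swap
    · rw [Set.indicator_of_notMem hw]
      exact zero_le
    rw [Set.indicator_of_mem hw, Set.indicator_of_mem]
    have h3 := norm_sub_le (z + w) z
    have h4 := norm_add_le z w
    rw [add_sub_cancel_left] at h3
    exact ⟨by linarith [hw.1], by linarith [hw.2]⟩
  calc ENNReal.ofReal (‖f z‖ ^ p)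
      = (volume A)⁻¹ * (ENNReal.ofReal (‖f z‖ ^ p) * volume A) := by
        rw [mul_comm _ (volume A), ← mul_assoc, ENNReal.inv_mul_cancel hA0 hAtop, one_mul]
    _ ≤ _ := by gcongr; exact h1.trans h2

lemma hasDerivAt_slice {f : EuclideanSpace ℂ (Fin n) → ℂ} (hf : Differentiable ℂ f)
    (z v : EuclideanSpace ℂ (Fin n)) :
    HasDerivAt (fun t : ℂ => f (z + t • v)) (fderiv ℂ f z v) 0 := by
  have h1 : HasDerivAt (fun t : ℂ => z + t • v) v 0 := by
    simpa using ((hasDerivAt_id (0 : ℂ)).smul_const v).const_add z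
  have h2 : HasFDerivAt f (fderiv ℂ f z) (z + (0 : ℂ) • v) := by
    simpa using (hf z).hasFDerivAt
  exact h2.comp_hasDerivAt 0 h1

/-- Cauchy estimate for the Fréchet derivative on a ball. -/
lemma norm_fderiv_le_of_norm_le {f : EuclideanSpace ℂ (Fin n) → ℂ} (hf : Differentiable ℂ f)
    {R M : ℝ} (hM : ∀ w, ‖w‖ ≤ R + 1 → ‖f w‖ ≤ M) {z : EuclideanSpace ℂ (Fin n)}
    (hz : ‖z‖ ≤ R) : ‖fderiv ℂ f z‖ ≤ M := by
  have hM0 : 0 ≤ M := (norm_nonneg _).trans (hM z (by linarith))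
  refine ContinuousLinearMap.opNorm_le_of_unit_norm (𝕜 := ℂ) hM0 fun v hv => ?_
  rw [← (hasDerivAt_slice hf z v).deriv]
  have := Complex.norm_deriv_le_of_forall_mem_sphere_norm_le (c := 0) (R := 1) (C := M)
    (f := fun t : ℂ => f (z + t • v)) one_pos
    (by fun_prop : Differentiable ℂ fun t : ℂ => f (z + t • v)).diffContOnCl
    fun t ht => hM _ ?_
  · simpa using this
  · have ht' : ‖t‖ = 1 := by simpa using ht
    have := norm_add_le z (t • v)
    rw [norm_smul, ht', hv] at this
    linarith

lemma fderiv_apply_eq_intervalIntegral {f : EuclideanSpace ℂ (Fin n) → ℂ}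
    (hf : Differentiable ℂ f) (z v : EuclideanSpace ℂ (Fin n)) :
    fderiv ℂ f z v = (2 * Real.pi * Complex.I : ℂ)⁻¹ • ∫ θ in 0..2 * Real.pi,
      (deriv (circleMap 0 1) θ * (circleMap 0 1 θ ^ 2)⁻¹) • f (z + circleMap 0 1 θ • v) := by
  have hd : Differentiable ℂ fun t : ℂ => f (z + t • v) := by fun_prop
  have := Complex.two_pi_I_inv_smul_circleIntegral_sub_sq_inv_smul_of_differentiable
    isOpen_univ (Set.subset_univ (Metric.closedBall (0 : ℂ) 1)) hd.differentiableOn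
    (Metric.mem_ball_self one_pos)
  rw [← (hasDerivAt_slice hf z v).deriv, ← this, circleIntegral]
  simp only [sub_zero, smul_smul]

/-- Directional derivatives of entire functions of several variables are entire. -/
lemma differentiable_fderiv_apply {f : EuclideanSpace ℂ (Fin n) → ℂ} (hf : Differentiable ℂ f)
    (v : EuclideanSpace ℂ (Fin n)) : Differentiable ℂ fun z => fderiv ℂ f z v := by
  intro z₀
  simp_rw [fderiv_apply_eq_intervalIntegral hf _ v]
  set c : ℝ → ℂ := fun θ => deriv (circleMap 0 1) θ * (circleMap 0 1 θ ^ 2)⁻¹ with hc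
  suffices h : DifferentiableAt ℂ (fun z => ∫ θ in 0..2 * Real.pi,
      c θ • f (z + circleMap 0 1 θ • v)) z₀ from h.const_smul (2 * Real.pi * Complex.I : ℂ)⁻¹
  have hcc : Continuous c := by
    have h1 := continuous_circleMap 0 1
    simp only [hc, deriv_circleMap]
    refine (h1.mul continuous_const).mul ((h1.pow 2).inv₀ fun θ => ?_)
    exact pow_ne_zero 2 (circleMap_ne_center one_ne_zero)
  have hcn : ∀ θ, ‖c θ‖ = 1 := by
    intro θ
    simp [hc, deriv_circleMap]
  have hfc := hf.continuous
  have hcm := continuous_circleMap 0 1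
  set R : ℝ := ‖z₀‖ + 1 + ‖v‖ with hR
  obtain ⟨M, hM⟩ := (isCompact_closedBall (0 : EuclideanSpace ℂ (Fin n))
    (R + 1)).exists_bound_of_continuousOn hfc.continuousOn
  have hM' : ∀ w : EuclideanSpace ℂ (Fin n), ‖w‖ ≤ R + 1 → ‖f w‖ ≤ M :=
    fun w hw => hM w (by simpa using hw)
  refine (intervalIntegral.hasFDerivAt_integral_of_dominated_of_fderiv_le
    (F := fun z θ => c θ • f (z + circleMap 0 1 θ • v))
    (F' := fun z θ => c θ • fderiv ℂ f (z + circleMap 0 1 θ • v))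
    (bound := fun _ => M) (s := Metric.ball z₀ 1) (Metric.ball_mem_nhds z₀ one_pos)
    ?_ ?_ ?_ ?_ ?_ ?_).differentiableAt
  · refine Filter.Eventually.of_forall fun z => Continuous.aestronglyMeasurable ?_
    fun_prop
  · refine Continuous.intervalIntegrable ?_ _ _
    fun_prop
  · refine AEStronglyMeasurable.smul hcc.aestronglyMeasurable ?_
    refine StronglyMeasurable.aestronglyMeasurable ?_
    have h1 : Measurable fun θ : ℝ => fderiv ℂ f (z₀ + circleMap 0 1 θ • v) :=
      (measurable_fderiv ℂ f).comp
        (by fun_prop : Continuous fun θ : ℝ => z₀ + circleMap 0 1 θ • v).measurable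
    exact h1.stronglyMeasurable
  · refine Filter.Eventually.of_forall fun θ _ z hz => ?_
    rw [norm_smul, hcn, one_mul]
    refine norm_fderiv_le_of_norm_le hf hM' ?_
    have h1 := norm_add_le z (circleMap 0 1 θ • v)
    have h2 : ‖z - z₀‖ < 1 := by simpa [dist_eq_norm] using hz
    have h3 := norm_le_norm_add_norm_sub z₀ z
    rw [norm_sub_rev] at h3
    rw [norm_smul, norm_circleMap_zero, abs_one, one_mul] at h1
    linarith
  · exact intervalIntegrable_const
  · refine Filter.Eventually.of_forall fun θ _ z _ => ?_
    have h1 : HasFDerivAt f (fderiv ℂ f (z + circleMap 0 1 θ • v)) (z + circleMap 0 1 θ • v) :=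
      (hf _).hasFDerivAt
    exact (h1.comp z ((hasFDerivAt_id z).add_const _)).const_smul (c θ)

/-- Entire functions of several complex variables are smooth. -/
lemma contDiff_of_entire (k : ℕ) : ∀ {f : EuclideanSpace ℂ (Fin n) → ℂ}, Differentiable ℂ f →
    ContDiff ℂ k f := by
  induction k with
  | zero => exact fun hf => contDiff_zero.2 hf.continuous
  | succ k ih =>
    intro f hf
    push_cast
    exact contDiff_succ_iff_fderiv_apply.2
      ⟨hf, by simp, fun v => ih (differentiable_fderiv_apply hf v)⟩

lemma iteratedDeriv_slice {f : EuclideanSpace ℂ (Fin n) → ℂ} (hf : Differentiable ℂ f)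
    (v : EuclideanSpace ℂ (Fin n)) (k : ℕ) :
    iteratedDeriv k (fun t : ℂ => f (t • v)) 0 = iteratedFDeriv ℂ k f 0 fun _ => v := by
  have h := (ContinuousLinearMap.toSpanSingleton ℂ v).iteratedFDeriv_comp_right
    (contDiff_of_entire k hf) 0 le_rfl
  have e : (fun t : ℂ => f (t • v)) = f ∘ ContinuousLinearMap.toSpanSingleton ℂ v := by
    ext t
    simp
  rw [iteratedDeriv_eq_iteratedFDeriv, e, h]
  simp

/-- The homogeneous expansion at the origin of an entire function. -/
lemma hasSum_iteratedFDeriv_of_entire {f : EuclideanSpace ℂ (Fin n) → ℂ}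
    (hf : Differentiable ℂ f) (z : EuclideanSpace ℂ (Fin n)) :
    HasSum (fun k : ℕ => (k.factorial : ℂ)⁻¹ * iteratedFDeriv ℂ k f 0 fun _ => z) (f z) := by
  have hd : Differentiable ℂ fun t : ℂ => f (t • z) := by fun_prop
  simpa [iteratedDeriv_slice hf] using Complex.hasSum_taylorSeries_of_entire hd 0 1

/-- Cauchy estimates for the homogeneous components, from a bound on the ball of radius `2`. -/
lemma norm_iteratedFDeriv_apply_le {f : EuclideanSpace ℂ (Fin n) → ℂ}
    (hf : Differentiable ℂ f) {S : ℝ} (hS : ∀ w, ‖w‖ ≤ 2 → ‖f w‖ ≤ S) (k : ℕ)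
    (z : EuclideanSpace ℂ (Fin n)) :
    ‖(k.factorial : ℂ)⁻¹ * iteratedFDeriv ℂ k f 0 fun _ => z‖ ≤ S * (1 / 2) ^ k * ‖z‖ ^ k := by
  have hS0 : 0 ≤ S := (norm_nonneg _).trans (hS 0 (by simp))
  rcases eq_or_ne z 0 with rfl | hz
  · rcases k with _ | k
    · simpa using hS 0 (by simp)
    · have : (iteratedFDeriv ℂ (k + 1) f 0 fun _ => (0 : EuclideanSpace ℂ (Fin n))) = 0 :=
        ContinuousMultilinearMap.map_coord_zero _ 0 rfl
      simp [this]
  have hz' : 0 < ‖z‖ := norm_pos_iff.2 hz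
  have hd : Differentiable ℂ fun t : ℂ => f (t • z) := by fun_prop
  have h := Complex.norm_iteratedDeriv_le_of_forall_mem_sphere_norm_le (c := 0) (R := 2 / ‖z‖)
    (C := S) (f := fun t : ℂ => f (t • z)) k (by positivity) hd.diffContOnCl fun t ht => hS _ ?_
  · rw [iteratedDeriv_slice hf] at h
    rw [norm_mul, norm_inv, Complex.norm_natCast, inv_mul_le_iff₀ (by positivity)]
    refine h.trans_eq ?_
    rw [div_pow, one_div, inv_pow]
    field_simp
  · have : ‖t‖ = 2 / ‖z‖ := by simpa using ht
    have hz0 := hz'.ne'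
    rw [norm_smul, this, div_mul_cancel₀ _ hz0]

/-- Bounds for the Taylor polynomial of degree at most `m` and for the corresponding tail. -/
lemma norm_taylor_split_le {f g h : EuclideanSpace ℂ (Fin n) → ℂ} (hf : Differentiable ℂ f)
    (hg : Differentiable ℂ g) (hh : Differentiable ℂ h) (hfgh : f = g + h) {m : ℕ}
    (hh0 : ∀ k ≤ m, iteratedFDeriv ℂ k h 0 = 0) (hg0 : ∀ k, m < k → iteratedFDeriv ℂ k g 0 = 0)
    {S : ℝ} (hS : ∀ w, ‖w‖ ≤ 2 → ‖f w‖ ≤ S) (z : EuclideanSpace ℂ (Fin n)) :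
    ‖g z‖ ≤ 2 * S * (1 + ‖z‖) ^ m ∧ (‖z‖ ≤ 1 → ‖h z‖ ≤ 2 * S * ‖z‖ ^ (m + 1)) := by
  have hS0 : 0 ≤ S := (norm_nonneg _).trans (hS 0 (by simp))
  have hadd : ∀ k, iteratedFDeriv ℂ k f 0 = iteratedFDeriv ℂ k g 0 + iteratedFDeriv ℂ k h 0 := by
    intro k
    rw [hfgh]
    exact iteratedFDeriv_add_apply (contDiff_of_entire k hg).contDiffAt
      (contDiff_of_entire k hh).contDiffAt
  have hgeom : ∀ a : ℝ, HasSum (fun k : ℕ => S * (1 / 2) ^ k * a) (2 * S * a) := by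
    intro a
    have := (hasSum_geometric_two.mul_left S).mul_right a
    rwa [mul_comm S 2] at this
  have hcoef := fun k => norm_iteratedFDeriv_apply_le hf hS k z
  refine ⟨(hasSum_iteratedFDeriv_of_entire hg z).norm_le_of_bounded (hgeom _) fun k => ?_,
    fun hz => (hasSum_iteratedFDeriv_of_entire hh z).norm_le_of_bounded (hgeom _) fun k => ?_⟩
  · rcases le_or_gt k m with hk | hk
    · have e : iteratedFDeriv ℂ k g 0 = iteratedFDeriv ℂ k f 0 := by
        rw [hadd, hh0 k hk, add_zero]
      rw [e]
      refine (hcoef k).trans ?_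
      gcongr
      calc ‖z‖ ^ k ≤ (1 + ‖z‖) ^ k := by gcongr; linarith
        _ ≤ (1 + ‖z‖) ^ m := pow_le_pow_right₀ (by linarith [norm_nonneg z]) hk
    · rw [hg0 k hk]
      simp only [zero_apply, mul_zero, norm_zero]
      positivity
  · rcases le_or_gt k m with hk | hk
    · rw [hh0 k hk]
      simp only [zero_apply, mul_zero, norm_zero]
      positivity
    · have e : iteratedFDeriv ℂ k h 0 = iteratedFDeriv ℂ k f 0 := by
        rw [hadd, hg0 k hk, zero_add]
      rw [e]
      refine (hcoef k).trans ?_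
      exact mul_le_mul_of_nonneg_left (pow_le_pow_of_le_one (norm_nonneg z) hz hk)
        (by positivity)

lemma exists_ofReal_norm_rpow_le_lintegral_weight (hn : 1 ≤ n) {p : ℝ} (hp : 0 < p)
    {W : EuclideanSpace ℂ (Fin n) → ℝ} {c : ℝ} (hc : 0 < c)
    (hW : ∀ w, 1 ≤ ‖w‖ → ‖w‖ ≤ 6 → c ≤ W w) :
    ∃ K : ENNReal, K ≠ ⊤ ∧ ∀ f : EuclideanSpace ℂ (Fin n) → ℂ, Differentiable ℂ f →
      ∀ z, ‖z‖ ≤ 2 → ENNReal.ofReal (‖f z‖ ^ p) ≤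
        K * ∫⁻ w, ENNReal.ofReal (‖f w‖ ^ p * Real.exp (-(p/2) * ‖w‖^2) * W w) := by
  obtain ⟨K, hK, hKf⟩ := exists_ofReal_norm_rpow_le_lintegral_annulus hn hp
  set d : ℝ := Real.exp (-(p/2) * 6 ^ 2) * c with hd
  have hd0 : 0 < d := by positivity
  refine ⟨K * ENNReal.ofReal d⁻¹, ENNReal.mul_ne_top hK ENNReal.ofReal_ne_top,
    fun f hf z hz => (hKf f hf z hz).trans ?_⟩
  rw [mul_assoc, ← lintegral_const_mul' _ _ ENNReal.ofReal_ne_top]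
  gcongr K * ?_
  have hB : MeasurableSet {w : EuclideanSpace ℂ (Fin n) | 1 ≤ ‖w‖ ∧ ‖w‖ ≤ 6} :=
    ((isClosed_le continuous_const continuous_norm).inter
      (isClosed_le continuous_norm continuous_const)).measurableSet
  refine (setLIntegral_mono' hB fun w hw => ?_).trans (setLIntegral_le_lintegral _ _)
  rw [← ENNReal.ofReal_mul (by positivity)]
  refine ENNReal.ofReal_le_ofReal ?_
  rw [inv_mul_eq_div, le_div_iff₀ hd0, mul_assoc]
  have h1 : d ≤ Real.exp (-(p/2) * ‖w‖^2) * W w := by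
    refine mul_le_mul (Real.exp_le_exp.2 ?_) (hW w hw.1 hw.2) hc.le (by positivity)
    have : ‖w‖ ^ 2 ≤ 6 ^ 2 := by gcongr; exact hw.2
    nlinarith
  gcongr

/-- Gaussians beat polynomial weights. -/
lemma lintegral_one_add_norm_rpow_mul_gaussian_ne_top {p : ℝ} (hp : 0 < p) (N : ℝ) :
    ∫⁻ z : EuclideanSpace ℂ (Fin n),
      ENNReal.ofReal ((1 + ‖z‖) ^ N * Real.exp (-(p/2) * ‖z‖^2)) ≠ ⊤ := by
  set r : ℝ := Module.finrank ℝ (EuclideanSpace ℂ (Fin n)) + 1 with hr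
  set M : ℝ := max (N + r) 0 with hM
  have hfin := finite_integral_one_add_norm (E := EuclideanSpace ℂ (Fin n)) (μ := volume)
    (r := r) (by rw [hr]; linarith)
  refine ne_top_of_le_ne_top (ENNReal.mul_ne_top
    (ENNReal.ofReal_ne_top (r := Real.exp (M ^ 2 / (2 * p)))) hfin.ne) ?_
  rw [← lintegral_const_mul' _ _ ENNReal.ofReal_ne_top]
  refine lintegral_mono fun z => ?_
  rw [← ENNReal.ofReal_mul (by positivity)]
  refine ENNReal.ofReal_le_ofReal ?_
  have h1 : 1 ≤ 1 + ‖z‖ := by linarith [norm_nonneg z]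
  have h0 : 0 < 1 + ‖z‖ := by linarith
  have hle : (1 + ‖z‖) ^ (N + r) ≤ Real.exp (M * ‖z‖) := by
    calc (1 + ‖z‖) ^ (N + r) ≤ (1 + ‖z‖) ^ M :=
          Real.rpow_le_rpow_of_exponent_le h1 (le_max_left _ _)
      _ ≤ (Real.exp ‖z‖) ^ M :=
        Real.rpow_le_rpow h0.le (by linarith [Real.add_one_le_exp ‖z‖]) (le_max_right _ _)
      _ = Real.exp (M * ‖z‖) := by rw [← Real.exp_mul, mul_comm]
  have hN : (1 + ‖z‖) ^ N = (1 + ‖z‖) ^ (N + r) * (1 + ‖z‖) ^ (-r) := by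
    rw [← Real.rpow_add h0, add_neg_cancel_right]
  have hexp : Real.exp (M * ‖z‖) * Real.exp (-(p/2) * ‖z‖^2) ≤ Real.exp (M ^ 2 / (2 * p)) := by
    rw [← Real.exp_add]
    refine Real.exp_le_exp.2 ?_
    rw [le_div_iff₀ (by positivity)]
    nlinarith [sq_nonneg (M - p * ‖z‖)]
  calc (1 + ‖z‖) ^ N * Real.exp (-(p/2) * ‖z‖^2)
      = (1 + ‖z‖) ^ (N + r) * Real.exp (-(p/2) * ‖z‖^2) * (1 + ‖z‖) ^ (-r) := by rw [hN]; ring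
    _ ≤ Real.exp (M * ‖z‖) * Real.exp (-(p/2) * ‖z‖^2) * (1 + ‖z‖) ^ (-r) := by gcongr
    _ ≤ Real.exp (M ^ 2 / (2 * p)) * (1 + ‖z‖) ^ (-r) := by gcongr

lemma norm_add_rpow_le {p : ℝ} (hp : 0 < p) (x y : ℂ) :
    ‖x + y‖ ^ p ≤ 2 ^ p * (‖x‖ ^ p + ‖y‖ ^ p) := by
  have hx : 0 ≤ ‖x‖ ^ p := by positivity
  have hy : 0 ≤ ‖y‖ ^ p := by positivity
  calc ‖x + y‖ ^ p ≤ (2 * max ‖x‖ ‖y‖) ^ p := by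
        refine Real.rpow_le_rpow (norm_nonneg _) ((norm_add_le x y).trans ?_) hp.le
        linarith [le_max_left ‖x‖ ‖y‖, le_max_right ‖x‖ ‖y‖]
    _ = 2 ^ p * max ‖x‖ ‖y‖ ^ p := Real.mul_rpow (by norm_num) (by positivity)
    _ ≤ 2 ^ p * (‖x‖ ^ p + ‖y‖ ^ p) := by
        gcongr
        rcases max_choice ‖x‖ ‖y‖ with h | h <;> rw [h] <;> linarith

lemma rpow_one_div_le_of_le_mul {I J K : ENNReal} (hK : K ≠ ⊤) {p : ℝ} (hp : 0 < p)
    (h : J ≤ K * I) :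
    J ^ (1 / p) ≤ ENNReal.ofReal ((K ^ (1 / p)).toReal) * I ^ (1 / p) := by
  have hp' : 0 ≤ 1 / p := by positivity
  rw [ENNReal.ofReal_toReal (ENNReal.rpow_ne_top_of_nonneg hp' hK),
    ← ENNReal.mul_rpow_of_nonneg _ _ hp']
  exact ENNReal.rpow_le_rpow h hp'

lemma add_le_two_mul_rpow_add {I J : ENNReal} {p : ℝ} (hp : 0 < p) :
    I + J ≤ 2 * (I ^ (1 / p) + J ^ (1 / p)) ^ p := by
  have e : ∀ x : ENNReal, x = (x ^ (1 / p)) ^ p := fun x => by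
    rw [← ENNReal.rpow_mul, one_div_mul_cancel hp.ne', ENNReal.rpow_one]
  rw [two_mul]
  refine add_le_add ?_ ?_
  · conv_lhs => rw [e I]
    exact ENNReal.rpow_le_rpow le_self_add hp.le
  · conv_lhs => rw [e J]
    exact ENNReal.rpow_le_rpow le_add_self hp.le

lemma lintegral_weight_le_of_nonpos (hn : 1 ≤ n) {p α : ℝ} (hp : 0 < p) (hα : α ≤ 0) :
    ∃ K : ENNReal, K ≠ ⊤ ∧ ∀ f : EuclideanSpace ℂ (Fin n) → ℂ, Differentiable ℂ f →
      ∫⁻ z, ENNReal.ofReal (‖f z‖ ^ p * Real.exp (-(p/2) * ‖z‖^2) * (1 + ‖z‖) ^ (-α)) ≤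
        K * ∫⁻ z, ENNReal.ofReal (‖f z‖ ^ p * Real.exp (-(p/2) * ‖z‖^2) * ‖z‖ ^ (-α)) := by
  obtain ⟨K, hK, hKf⟩ := exists_ofReal_norm_rpow_le_lintegral_weight hn hp (c := 1)
    (W := fun w : EuclideanSpace ℂ (Fin n) => ‖w‖ ^ (-α)) one_pos
    fun w hw _ => Real.one_le_rpow hw (by linarith)
  set V := volume (Metric.closedBall (0 : EuclideanSpace ℂ (Fin n)) 1) with hV
  have hVtop : V ≠ ⊤ := measure_closedBall_lt_top.ne
  refine ⟨ENNReal.ofReal (2 ^ (-α)) * (K * V + 1), ENNReal.mul_ne_top ENNReal.ofReal_ne_top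
    (ENNReal.add_ne_top.2 ⟨ENNReal.mul_ne_top hK hVtop, ENNReal.one_ne_top⟩), fun f hf => ?_⟩
  set I := ∫⁻ z, ENNReal.ofReal (‖f z‖ ^ p * Real.exp (-(p/2) * ‖z‖^2) * ‖z‖ ^ (-α)) with hI
  have hB : MeasurableSet (Metric.closedBall (0 : EuclideanSpace ℂ (Fin n)) 1) :=
    Metric.isClosed_closedBall.measurableSet
  calc ∫⁻ z, ENNReal.ofReal (‖f z‖ ^ p * Real.exp (-(p/2) * ‖z‖^2) * (1 + ‖z‖) ^ (-α))
      ≤ ∫⁻ z, ENNReal.ofReal (2 ^ (-α)) *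
          ((Metric.closedBall (0 : EuclideanSpace ℂ (Fin n)) 1).indicator (fun _ => K * I) z +
          ENNReal.ofReal (‖f z‖ ^ p * Real.exp (-(p/2) * ‖z‖^2) * ‖z‖ ^ (-α))) := by
        refine lintegral_mono fun z => ?_
        rcases le_total ‖z‖ 1 with hz | hz
        · rw [Set.indicator_of_mem (by simpa using hz)]
          refine le_trans ?_ (mul_le_mul_right (le_self_add.trans' (hKf f hf z (by linarith))) _)
          rw [← ENNReal.ofReal_mul (by positivity)]
          refine ENNReal.ofReal_le_ofReal ?_
          have h1 : Real.exp (-(p/2) * ‖z‖^2) ≤ 1 :=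
            Real.exp_le_one_iff.2 (by nlinarith [sq_nonneg ‖z‖])
          have h2 : (1 + ‖z‖) ^ (-α) ≤ 2 ^ (-α) :=
            Real.rpow_le_rpow (by positivity) (by linarith) (by linarith)
          calc ‖f z‖ ^ p * Real.exp (-(p/2) * ‖z‖^2) * (1 + ‖z‖) ^ (-α)
              ≤ ‖f z‖ ^ p * 1 * 2 ^ (-α) := by gcongr
            _ = 2 ^ (-α) * ‖f z‖ ^ p := by ring
        · refine le_trans ?_ (mul_le_mul_right le_add_self _)
          rw [← ENNReal.ofReal_mul (by positivity)]
          refine ENNReal.ofReal_le_ofReal ?_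
          have h2 : (1 + ‖z‖) ^ (-α) ≤ 2 ^ (-α) * ‖z‖ ^ (-α) := by
            rw [← Real.mul_rpow (by norm_num) (by positivity)]
            exact Real.rpow_le_rpow (by positivity) (by linarith) (by linarith)
          calc ‖f z‖ ^ p * Real.exp (-(p/2) * ‖z‖^2) * (1 + ‖z‖) ^ (-α)
              ≤ ‖f z‖ ^ p * Real.exp (-(p/2) * ‖z‖^2) * (2 ^ (-α) * ‖z‖ ^ (-α)) := by gcongr
            _ = _ := by ring
    _ = ENNReal.ofReal (2 ^ (-α)) * (K * V + 1) * I := by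
        rw [lintegral_const_mul' _ _ ENNReal.ofReal_ne_top,
          lintegral_add_left (measurable_const.indicator hB), lintegral_indicator_const hB, ← hI]
        ring

lemma lintegral_taylor_split_le (hn : 1 ≤ n) {p α : ℝ} (hp : 0 < p) (hα : 0 < α) :
    ∃ K : ENNReal, K ≠ ⊤ ∧ ∀ f g h : EuclideanSpace ℂ (Fin n) → ℂ,
      Differentiable ℂ f → Differentiable ℂ g → Differentiable ℂ h → f = g + h →
      (∀ k : ℕ, (k : ℝ) ≤ α/p → iteratedFDeriv ℂ k h 0 = 0) →
      (∀ k : ℕ, α/p < (k : ℝ) → iteratedFDeriv ℂ k g 0 = 0) →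
      ∫⁻ z, ENNReal.ofReal (‖g z‖ ^ p * Real.exp (-(p/2) * ‖z‖^2)) ≤
        K * ∫⁻ z, ENNReal.ofReal
          (‖f z‖ ^ p * Real.exp (-(p/2) * ‖z‖^2) * (1 + ‖z‖) ^ (-α)) ∧
      ∫⁻ z, ENNReal.ofReal (‖h z‖ ^ p * Real.exp (-(p/2) * ‖z‖^2) * ‖z‖ ^ (-α)) ≤
        K * ∫⁻ z, ENNReal.ofReal
          (‖f z‖ ^ p * Real.exp (-(p/2) * ‖z‖^2) * (1 + ‖z‖) ^ (-α)) := by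
  obtain ⟨K, hK, hKf⟩ := exists_ofReal_norm_rpow_le_lintegral_weight hn hp (c := 7 ^ (-α))
    (W := fun w : EuclideanSpace ℂ (Fin n) => (1 + ‖w‖) ^ (-α)) (by positivity)
    fun w _ hw => Real.rpow_le_rpow_of_nonpos (by positivity) (by linarith) (by linarith)
  set m : ℕ := ⌊α / p⌋₊ with hm
  have hαp : 0 ≤ α / p := by positivity
  have hmp : 0 ≤ ((m + 1 : ℕ) : ℝ) * p + -α := by
    have h1 : α / p < (m : ℝ) + 1 := Nat.lt_floor_add_one _
    rw [div_lt_iff₀ hp] at h1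
    push_cast
    linarith
  set V := volume (Metric.closedBall (0 : EuclideanSpace ℂ (Fin n)) 1) with hV
  have hVtop : V ≠ ⊤ := measure_closedBall_lt_top.ne
  set G := ∫⁻ z : EuclideanSpace ℂ (Fin n),
      ENNReal.ofReal ((1 + ‖z‖) ^ ((m : ℝ) * p) * Real.exp (-(p/2) * ‖z‖^2)) with hG
  have hGtop : G ≠ ⊤ := lintegral_one_add_norm_rpow_mul_gaussian_ne_top hp _
  set Kg := ENNReal.ofReal (2 ^ p) * K * G with hKg
  set Kh := ENNReal.ofReal (2 ^ p) * K * V + ENNReal.ofReal (2 ^ α * 2 ^ p) * (1 + Kg) with hKh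
  have hKgtop : Kg ≠ ⊤ :=
    ENNReal.mul_ne_top (ENNReal.mul_ne_top ENNReal.ofReal_ne_top hK) hGtop
  have hKhtop : Kh ≠ ⊤ := ENNReal.add_ne_top.2
    ⟨ENNReal.mul_ne_top (ENNReal.mul_ne_top ENNReal.ofReal_ne_top hK) hVtop,
      ENNReal.mul_ne_top ENNReal.ofReal_ne_top (ENNReal.add_ne_top.2 ⟨ENNReal.one_ne_top, hKgtop⟩)⟩
  refine ⟨Kg + Kh, ENNReal.add_ne_top.2 ⟨hKgtop, hKhtop⟩,
    fun f g h hf hg hh hfgh hh0 hg0 => ?_⟩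
  set J := ∫⁻ z, ENNReal.ofReal (‖f z‖ ^ p * Real.exp (-(p/2) * ‖z‖^2) * (1 + ‖z‖) ^ (-α))
    with hJ
  set Ig := ∫⁻ z, ENNReal.ofReal (‖g z‖ ^ p * Real.exp (-(p/2) * ‖z‖^2)) with hIg
  obtain ⟨z₀, hz₀, hmax⟩ := (isCompact_closedBall (0 : EuclideanSpace ℂ (Fin n)) 2).exists_isMaxOn
    ⟨0, by simp⟩ hf.continuous.norm.continuousOn
  set S := ‖f z₀‖ with hSdef
  have hS : ∀ w : EuclideanSpace ℂ (Fin n), ‖w‖ ≤ 2 → ‖f w‖ ≤ S :=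
    fun w hw => hmax (by simpa using hw)
  have hS0 : 0 ≤ S := norm_nonneg _
  have hSJ : ENNReal.ofReal (S ^ p) ≤ K * J := hKf f hf z₀ (by simpa using hz₀)
  have hsplit := norm_taylor_split_le hf hg hh hfgh (m := m)
    (fun k hk => hh0 k ((Nat.le_floor_iff hαp).1 hk))
    (fun k hk => hg0 k ((Nat.floor_lt hαp).1 hk)) hS
  have hSJ' : ENNReal.ofReal ((2 * S) ^ p) ≤ ENNReal.ofReal (2 ^ p) * (K * J) := by
    rw [Real.mul_rpow (by norm_num) hS0, ENNReal.ofReal_mul (by positivity)]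
    gcongr
  have hgle : Ig ≤ Kg * J := by
    calc Ig ≤ ∫⁻ z : EuclideanSpace ℂ (Fin n), ENNReal.ofReal ((2 * S) ^ p) *
          ENNReal.ofReal ((1 + ‖z‖) ^ ((m : ℝ) * p) * Real.exp (-(p/2) * ‖z‖^2)) := by
          refine lintegral_mono fun z => ?_
          rw [← ENNReal.ofReal_mul (by positivity), ← mul_assoc]
          refine ENNReal.ofReal_le_ofReal ?_
          gcongr
          rw [Real.rpow_mul (by positivity), Real.rpow_natCast,
            ← Real.mul_rpow (by positivity) (by positivity)]
          exact Real.rpow_le_rpow (norm_nonneg _) (hsplit z).1 hp.le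
      _ = ENNReal.ofReal ((2 * S) ^ p) * G := lintegral_const_mul' _ _ ENNReal.ofReal_ne_top
      _ ≤ ENNReal.ofReal (2 ^ p) * (K * J) * G := by gcongr
      _ = Kg * J := by rw [hKg]; ring
  refine ⟨hgle.trans (mul_le_mul_left le_self_add _), le_trans ?_ (mul_le_mul_left le_add_self _)⟩
  have hB : MeasurableSet (Metric.closedBall (0 : EuclideanSpace ℂ (Fin n)) 1) :=
    Metric.isClosed_closedBall.measurableSet
  have hgm : Measurable fun z : EuclideanSpace ℂ (Fin n) =>
      ENNReal.ofReal (‖g z‖ ^ p * Real.exp (-(p/2) * ‖z‖^2)) := by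
    have hc : Continuous fun z : EuclideanSpace ℂ (Fin n) => ‖g z‖ ^ p :=
      hg.continuous.norm.rpow_const fun _ => Or.inr hp.le
    exact (ENNReal.continuous_ofReal.comp
      (by fun_prop : Continuous fun z => ‖g z‖ ^ p * Real.exp (-(p/2) * ‖z‖^2))).measurable
  calc ∫⁻ z, ENNReal.ofReal (‖h z‖ ^ p * Real.exp (-(p/2) * ‖z‖^2) * ‖z‖ ^ (-α))
      ≤ ∫⁻ z, ((Metric.closedBall (0 : EuclideanSpace ℂ (Fin n)) 1).indicator
            (fun _ => ENNReal.ofReal ((2 * S) ^ p)) z +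
          ENNReal.ofReal (2 ^ α * 2 ^ p) *
            (ENNReal.ofReal (‖g z‖ ^ p * Real.exp (-(p/2) * ‖z‖^2)) +
              ENNReal.ofReal (‖f z‖ ^ p * Real.exp (-(p/2) * ‖z‖^2) * (1 + ‖z‖) ^ (-α)))) := by
        refine lintegral_mono fun z => ?_
        rcases le_total ‖z‖ 1 with hz | hz
        · rw [Set.indicator_of_mem (by simpa using hz)]
          refine le_add_right (ENNReal.ofReal_le_ofReal ?_)
          have h1 : Real.exp (-(p/2) * ‖z‖^2) ≤ 1 :=
            Real.exp_le_one_iff.2 (by nlinarith [sq_nonneg ‖z‖])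
          have h2 : ‖h z‖ ^ p ≤ (2 * S) ^ p * ‖z‖ ^ (((m + 1 : ℕ) : ℝ) * p) := by
            rw [Real.rpow_mul (norm_nonneg z), Real.rpow_natCast,
              ← Real.mul_rpow (by positivity) (by positivity)]
            exact Real.rpow_le_rpow (norm_nonneg _) ((hsplit z).2 hz) hp.le
          have h3 : ‖z‖ ^ (((m + 1 : ℕ) : ℝ) * p) * ‖z‖ ^ (-α) ≤ 1 := by
            rcases eq_or_ne z 0 with rfl | hz0
            · rw [norm_zero, Real.zero_rpow (by linarith : -α ≠ 0), mul_zero]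
              exact zero_le_one
            · rw [← Real.rpow_add (norm_pos_iff.2 hz0)]
              exact Real.rpow_le_one (norm_nonneg z) hz hmp
          calc ‖h z‖ ^ p * Real.exp (-(p/2) * ‖z‖^2) * ‖z‖ ^ (-α)
              ≤ (2 * S) ^ p * ‖z‖ ^ (((m + 1 : ℕ) : ℝ) * p) * 1 * ‖z‖ ^ (-α) := by gcongr
            _ = (2 * S) ^ p * (‖z‖ ^ (((m + 1 : ℕ) : ℝ) * p) * ‖z‖ ^ (-α)) := by ring
            _ ≤ (2 * S) ^ p := mul_le_of_le_one_right (by positivity) h3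
        · refine le_add_left ?_
          rw [← ENNReal.ofReal_add (by positivity) (by positivity),
            ← ENNReal.ofReal_mul (by positivity)]
          refine ENNReal.ofReal_le_ofReal ?_
          have h1 : ‖h z‖ ^ p ≤ 2 ^ p * (‖f z‖ ^ p + ‖g z‖ ^ p) := by
            have := norm_add_rpow_le hp (f z) (-g z)
            rwa [norm_neg, show f z + -g z = h z by rw [hfgh, Pi.add_apply]; ring] at this
          have h2 : ‖z‖ ^ (-α) ≤ 2 ^ α * (1 + ‖z‖) ^ (-α) := by
            have e : (2 : ℝ) ^ α = (2⁻¹ : ℝ) ^ (-α) := by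
              rw [Real.rpow_neg (by norm_num), Real.inv_rpow (by norm_num), inv_inv]
            rw [e, ← Real.mul_rpow (by norm_num) (by positivity)]
            exact Real.rpow_le_rpow_of_nonpos (by positivity) (by linarith) (by linarith)
          have h3 : (1 + ‖z‖) ^ (-α) ≤ 1 :=
            Real.rpow_le_one_of_one_le_of_nonpos (by linarith) (by linarith)
          calc ‖h z‖ ^ p * Real.exp (-(p/2) * ‖z‖^2) * ‖z‖ ^ (-α)
              ≤ 2 ^ p * (‖f z‖ ^ p + ‖g z‖ ^ p) * Real.exp (-(p/2) * ‖z‖^2) *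
                  (2 ^ α * (1 + ‖z‖) ^ (-α)) := by gcongr
            _ = 2 ^ α * 2 ^ p * (‖g z‖ ^ p * Real.exp (-(p/2) * ‖z‖^2) * (1 + ‖z‖) ^ (-α) +
                  ‖f z‖ ^ p * Real.exp (-(p/2) * ‖z‖^2) * (1 + ‖z‖) ^ (-α)) := by ring
            _ ≤ 2 ^ α * 2 ^ p * (‖g z‖ ^ p * Real.exp (-(p/2) * ‖z‖^2) +
                  ‖f z‖ ^ p * Real.exp (-(p/2) * ‖z‖^2) * (1 + ‖z‖) ^ (-α)) :=
                mul_le_mul_of_nonneg_left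
                  (add_le_add (mul_le_of_le_one_right (by positivity) h3) le_rfl) (by positivity)
    _ = ENNReal.ofReal ((2 * S) ^ p) * V + ENNReal.ofReal (2 ^ α * 2 ^ p) * (Ig + J) := by
        rw [lintegral_add_left (measurable_const.indicator hB), lintegral_indicator_const hB,
          lintegral_const_mul' _ _ ENNReal.ofReal_ne_top, lintegral_add_left hgm]
    _ ≤ ENNReal.ofReal (2 ^ p) * (K * J) * V +
          ENNReal.ofReal (2 ^ α * 2 ^ p) * (Kg * J + J) := by gcongr
    _ = Kh * J := by rw [hKh]; ring

lemma lintegral_le_taylor_split {p α : ℝ} (hp : 0 < p) (hα : 0 < α)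
    {f g h : EuclideanSpace ℂ (Fin n) → ℂ} (hg : Differentiable ℂ g) (hfgh : f = g + h)
    (hh0 : h 0 = 0) :
    ∫⁻ z, ENNReal.ofReal (‖f z‖ ^ p * Real.exp (-(p/2) * ‖z‖^2) * (1 + ‖z‖) ^ (-α)) ≤
      ENNReal.ofReal (2 ^ p) *
        ((∫⁻ z, ENNReal.ofReal (‖g z‖ ^ p * Real.exp (-(p/2) * ‖z‖^2))) +
          ∫⁻ z, ENNReal.ofReal (‖h z‖ ^ p * Real.exp (-(p/2) * ‖z‖^2) * ‖z‖ ^ (-α))) := by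
  have hgm : Measurable fun z : EuclideanSpace ℂ (Fin n) =>
      ENNReal.ofReal (‖g z‖ ^ p * Real.exp (-(p/2) * ‖z‖^2)) := by
    have hc : Continuous fun z : EuclideanSpace ℂ (Fin n) => ‖g z‖ ^ p :=
      hg.continuous.norm.rpow_const fun _ => Or.inr hp.le
    exact (ENNReal.continuous_ofReal.comp
      (by fun_prop : Continuous fun z => ‖g z‖ ^ p * Real.exp (-(p/2) * ‖z‖^2))).measurable
  rw [← lintegral_add_left hgm, ← lintegral_const_mul' _ _ ENNReal.ofReal_ne_top]
  refine lintegral_mono fun z => ?_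
  rw [← ENNReal.ofReal_add (by positivity) (by positivity), ← ENNReal.ofReal_mul (by positivity)]
  refine ENNReal.ofReal_le_ofReal ?_
  have h1 : ‖f z‖ ^ p ≤ 2 ^ p * (‖g z‖ ^ p + ‖h z‖ ^ p) := by
    rw [hfgh]
    exact norm_add_rpow_le hp (g z) (h z)
  have h3 : (1 + ‖z‖) ^ (-α) ≤ 1 :=
    Real.rpow_le_one_of_one_le_of_nonpos (by linarith [norm_nonneg z]) (by linarith)
  have h4 : ‖h z‖ ^ p * Real.exp (-(p/2) * ‖z‖^2) * (1 + ‖z‖) ^ (-α) ≤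
      ‖h z‖ ^ p * Real.exp (-(p/2) * ‖z‖^2) * ‖z‖ ^ (-α) := by
    rcases eq_or_ne z 0 with rfl | hz
    · simp [hh0, Real.zero_rpow hp.ne']
    · gcongr ?_ * ?_
      exact Real.rpow_le_rpow_of_nonpos (norm_pos_iff.2 hz) (by linarith) (by linarith)
  calc ‖f z‖ ^ p * Real.exp (-(p/2) * ‖z‖^2) * (1 + ‖z‖) ^ (-α)
      ≤ 2 ^ p * (‖g z‖ ^ p + ‖h z‖ ^ p) * Real.exp (-(p/2) * ‖z‖^2) *
          (1 + ‖z‖) ^ (-α) := by gcongr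
    _ = 2 ^ p * (‖g z‖ ^ p * Real.exp (-(p/2) * ‖z‖^2) * (1 + ‖z‖) ^ (-α) +
          ‖h z‖ ^ p * Real.exp (-(p/2) * ‖z‖^2) * (1 + ‖z‖) ^ (-α)) := by ring
    _ ≤ _ := mul_le_mul_of_nonneg_left
        (add_le_add (mul_le_of_le_one_right (by positivity) h3) h4) (by positivity)

end

theorem stmt_12 (n : ℕ) (hn : 1 ≤ n) (p α : ℝ) (hp : 0 < p) :
    ∃ C > 0,
      (α ≤ 0 → ∀ f : EuclideanSpace ℂ (Fin n) → ℂ, Differentiable ℂ f →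
        ((∫⁻ z, ENNReal.ofReal
              (‖f z‖ ^ p * Real.exp (-(p/2) * ‖z‖^2) * ‖z‖ ^ (-α))) ^ (1/p) ≤
            ENNReal.ofReal C *
              (∫⁻ z, ENNReal.ofReal
                (‖f z‖ ^ p * Real.exp (-(p/2) * ‖z‖^2) * (1 + ‖z‖) ^ (-α))) ^ (1/p) ∧
          (∫⁻ z, ENNReal.ofReal
              (‖f z‖ ^ p * Real.exp (-(p/2) * ‖z‖^2) * (1 + ‖z‖) ^ (-α))) ^ (1/p) ≤
            ENNReal.ofReal C *
              (∫⁻ z, ENNReal.ofReal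
                (‖f z‖ ^ p * Real.exp (-(p/2) * ‖z‖^2) * ‖z‖ ^ (-α))) ^ (1/p))) ∧
      (0 < α → ∀ f g h : EuclideanSpace ℂ (Fin n) → ℂ,
        Differentiable ℂ f → Differentiable ℂ g → Differentiable ℂ h →
        f = g + h →
        (∀ k : ℕ, (k : ℝ) ≤ α/p → iteratedFDeriv ℂ k h 0 = 0) →
        (∀ k : ℕ, α/p < (k : ℝ) → iteratedFDeriv ℂ k g 0 = 0) →
        ((∫⁻ z, ENNReal.ofReal
              (‖g z‖ ^ p * Real.exp (-(p/2) * ‖z‖^2))) ^ (1/p) +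
            (∫⁻ z, ENNReal.ofReal
              (‖h z‖ ^ p * Real.exp (-(p/2) * ‖z‖^2) * ‖z‖ ^ (-α))) ^ (1/p) ≤
          ENNReal.ofReal C *
            (∫⁻ z, ENNReal.ofReal
              (‖f z‖ ^ p * Real.exp (-(p/2) * ‖z‖^2) * (1 + ‖z‖) ^ (-α))) ^ (1/p) ∧
        (∫⁻ z, ENNReal.ofReal
            (‖f z‖ ^ p * Real.exp (-(p/2) * ‖z‖^2) * (1 + ‖z‖) ^ (-α))) ^ (1/p) ≤
          ENNReal.ofReal C *
            ((∫⁻ z, ENNReal.ofReal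
                (‖g z‖ ^ p * Real.exp (-(p/2) * ‖z‖^2))) ^ (1/p) +
              (∫⁻ z, ENNReal.ofReal
                (‖h z‖ ^ p * Real.exp (-(p/2) * ‖z‖^2) * ‖z‖ ^ (-α))) ^ (1/p)))) := by
  rcases le_or_gt α 0 with hα | hα
  · obtain ⟨K, hK, hKf⟩ := lintegral_weight_le_of_nonpos hn hp hα
    refine ⟨(K ^ (1 / p)).toReal + 1, by positivity, fun _ f hf => ⟨?_, ?_⟩,
      fun h => absurd h hα.not_gt⟩
    · refine le_trans ?_ (mul_le_mul_left (ENNReal.one_le_ofReal.2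
        (le_add_of_nonneg_left ENNReal.toReal_nonneg)) _)
      rw [one_mul]
      refine ENNReal.rpow_le_rpow (lintegral_mono fun z => ENNReal.ofReal_le_ofReal ?_)
        (by positivity)
      gcongr ?_ * ?_
      exact Real.rpow_le_rpow (norm_nonneg z) (by linarith) (by linarith)
    · refine (rpow_one_div_le_of_le_mul hK hp (hKf f hf)).trans (mul_le_mul_left ?_ _)
      exact ENNReal.ofReal_le_ofReal (by linarith)
  · obtain ⟨K, hK, hKf⟩ := lintegral_taylor_split_le hn hp hα
    set D : ENNReal := ENNReal.ofReal (2 ^ p) * 2 with hD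
    have hDtop : D ≠ ⊤ := ENNReal.mul_ne_top ENNReal.ofReal_ne_top ENNReal.ofNat_ne_top
    have ha : 0 ≤ (K ^ (1 / p)).toReal := ENNReal.toReal_nonneg
    have hb : 0 ≤ (D ^ (1 / p)).toReal := ENNReal.toReal_nonneg
    refine ⟨2 * (K ^ (1 / p)).toReal + (D ^ (1 / p)).toReal + 1, by positivity,
      fun h => absurd hα h.not_gt, fun _ f g h hf hg hh hfgh hh0 hg0 => ⟨?_, ?_⟩⟩
    · obtain ⟨h1, h2⟩ := hKf f g h hf hg hh hfgh hh0 hg0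
      refine (add_le_add (rpow_one_div_le_of_le_mul hK hp h1)
        (rpow_one_div_le_of_le_mul hK hp h2)).trans ?_
      rw [← two_mul, ← mul_assoc]
      refine mul_le_mul_left ?_ _
      rw [← ENNReal.ofReal_ofNat 2, ← ENNReal.ofReal_mul (by norm_num)]
      exact ENNReal.ofReal_le_ofReal (by linarith)
    · have hh00 : h 0 = 0 := by
        have := congrArg (fun T => T fun _ => 0) (hh0 0 (by rw [Nat.cast_zero]; positivity))
        simpa using this
      have h1 := (lintegral_le_taylor_split hp hα hg hfgh hh00).trans
        (mul_le_mul_right (add_le_two_mul_rpow_add hp) _)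
      rw [← mul_assoc] at h1
      have h2 := rpow_one_div_le_of_le_mul hDtop hp h1
      rw [← ENNReal.rpow_mul _ p (1 / p), mul_one_div_cancel hp.ne', ENNReal.rpow_one] at h2
      exact h2.trans (mul_le_mul_left (ENNReal.ofReal_le_ofReal (by linarith)) _)
end

section
/- Let μ be a nonnegative Borel measure on ℂⁿ such that for some r > 0, sup_z μ(B(z,r)) < ∞. Then for every entire function f and every 1 ≤ p < ∞, ∫_{|z|≥r} |f(z)e^{-|z|²/2}|^p dμ(z) ≤ C sup_w μ(B(w,r)) ∫_{ℂⁿ} |f(w) e^{-|w|²/2}|^p dv(w), where C depends only on r, p, n. -/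
open MeasureTheory

open ProbabilityTheory in
/-- Jensen's inequality for the power function and the average of a nonnegative function. -/
theorem rpow_mul_measure_le_setLIntegral_rpow {α : Type*} [MeasurableSpace α] {ν : Measure α}
    {s : Set α} (h0 : ν s ≠ 0) (htop : ν s ≠ ⊤) {g : α → ENNReal} (hg : Measurable g)
    {a : ENNReal} {p : ℝ} (hp : 1 ≤ p) (h : a * ν s ≤ ∫⁻ x in s, g x ∂ν) :
    a ^ p * ν s ≤ ∫⁻ x in s, g x ^ p ∂ν := by
  have hp0 : 0 < p := by linarith
  have := cond_isProbabilityMeasure_of_finite h0 htop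
  have hcond : ∀ u : α → ENNReal, ∫⁻ x, u x ∂(ν[|s]) = (∫⁻ x in s, u x ∂ν) / ν s := by
    intro u
    rw [ProbabilityTheory.cond, lintegral_smul_measure, smul_eq_mul, ENNReal.div_eq_inv_mul]
  have hJ : (∫⁻ x, g x ∂(ν[|s])) ^ p ≤ ∫⁻ x, g x ^ p ∂(ν[|s]) := by
    have := eLpNorm_le_eLpNorm_of_exponent_le (μ := ν[|s]) (f := g) (p := 1)
      (q := ENNReal.ofReal p) (by simpa using hp) hg.aestronglyMeasurable
    rw [eLpNorm_one_eq_lintegral_enorm, eLpNorm_eq_lintegral_rpow_enorm_toReal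
      (by simpa using hp0) ENNReal.ofReal_ne_top, ENNReal.toReal_ofReal hp0.le] at this
    simp only [enorm_eq_self] at this
    simpa [← ENNReal.rpow_mul, hp0.ne'] using ENNReal.rpow_le_rpow this hp0.le
  rw [hcond, hcond] at hJ
  rw [← ENNReal.le_div_iff_mul_le (.inl h0) (.inl htop)] at h ⊢
  exact (ENNReal.rpow_le_rpow h hp0.le).trans hJ

/-- The sub-mean-value inequality for the modulus of an entire function on a circle in a complex
line. -/
theorem Differentiable.enorm_mul_two_pi_le_lintegral_circleMap {E : Type*} [NormedAddCommGroup E]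
    [NormedSpace ℂ E] {f : E → ℂ} (hf : Differentiable ℂ f) (z u : E) :
    ‖f z‖ₑ * ENNReal.ofReal (2 * Real.pi) ≤
      ∫⁻ θ in Set.Ioc 0 (2 * Real.pi), ‖f (z + circleMap 0 1 θ • u)‖ₑ := by
  have hd : Differentiable ℂ fun ζ : ℂ ↦ f (z + ζ • u) := by fun_prop
  have hm := DiffContOnCl.circleAverage (hd.diffContOnCl (s := Metric.ball 0 |(1 : ℝ)|))
  rw [Real.circleAverage_def, intervalIntegral.integral_of_le Real.two_pi_pos.le] at hm
  simp only [zero_smul, add_zero] at hm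
  have hI : (∫ θ in Set.Ioc 0 (2 * Real.pi), f (z + circleMap 0 1 θ • u)) =
      (2 * Real.pi) • f z := by
    rw [← hm, smul_inv_smul₀ Real.two_pi_pos.ne']
  have := enorm_integral_le_lintegral_enorm (μ := volume.restrict (Set.Ioc 0 (2 * Real.pi)))
    fun θ ↦ f (z + circleMap 0 1 θ • u)
  rwa [hI, enorm_smul, Real.enorm_of_nonneg Real.two_pi_pos.le, mul_comm] at this

/-- The sub-mean-value inequality for the modulus of an entire function on a ball, with respect to
a rotation-invariant measure. -/
theorem Differentiable.enorm_mul_measure_ball_le_setLIntegral {E : Type*} [NormedAddCommGroup E]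
    [NormedSpace ℂ E] [SecondCountableTopology E] [MeasurableSpace E] [BorelSpace E]
    {ν : Measure E} [SFinite ν] [SMulInvariantMeasure Circle E ν] {f : E → ℂ}
    (hf : Differentiable ℂ f) (z : E) (s : ℝ) :
    ‖f z‖ₑ * ν (Metric.ball 0 s) ≤ ∫⁻ w in Metric.ball 0 s, ‖f (z + w)‖ₑ ∂ν := by
  have hc := hf.continuous
  have hrot : ∀ θ : ℝ, ∫⁻ u in Metric.ball 0 s, ‖f (z + circleMap 0 1 θ • u)‖ₑ ∂ν =
      ∫⁻ w in Metric.ball 0 s, ‖f (z + w)‖ₑ ∂ν := by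
    intro θ
    have hpre : (fun u : E ↦ Circle.exp θ • u) ⁻¹' Metric.ball 0 s = Metric.ball 0 s := by
      ext u
      simp [Circle.smul_def, norm_smul]
    have := (measurePreserving_smul (Circle.exp θ) ν).setLIntegral_comp_preimage
      (f := fun w ↦ ‖f (z + w)‖ₑ) (Metric.isOpen_ball (x := (0 : E)) (ε := s)).measurableSet
      (hc.comp (continuous_const_add z)).measurable.enorm
    rw [hpre] at this
    simpa [circleMap, Circle.smul_def] using this
  have hpi : ENNReal.ofReal (2 * Real.pi) ≠ 0 := by
    simpa using Real.pi_pos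
  rw [← ENNReal.mul_le_mul_iff_left hpi ENNReal.ofReal_ne_top]
  calc ‖f z‖ₑ * ν (Metric.ball 0 s) * ENNReal.ofReal (2 * Real.pi)
      = ∫⁻ _ in Metric.ball 0 s, ‖f z‖ₑ * ENNReal.ofReal (2 * Real.pi) ∂ν := by
        rw [setLIntegral_const, mul_right_comm]
    _ ≤ ∫⁻ u in Metric.ball 0 s, ∫⁻ θ in Set.Ioc 0 (2 * Real.pi),
          ‖f (z + circleMap 0 1 θ • u)‖ₑ ∂volume ∂ν :=
        lintegral_mono fun u ↦ hf.enorm_mul_two_pi_le_lintegral_circleMap z u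
    _ = ∫⁻ θ in Set.Ioc 0 (2 * Real.pi), ∫⁻ u in Metric.ball 0 s,
          ‖f (z + circleMap 0 1 θ • u)‖ₑ ∂ν := by
        refine lintegral_lintegral_swap (Measurable.aemeasurable ?_)
        have : Continuous fun q : E × ℝ ↦ f (z + circleMap 0 1 q.2 • q.1) := by
          have := continuous_circleMap 0 1
          fun_prop
        exact this.measurable.enorm
    _ = (∫⁻ w in Metric.ball 0 s, ‖f (z + w)‖ₑ ∂ν) * ENNReal.ofReal (2 * Real.pi) := by
        simp [hrot]

/-- The sub-mean-value inequality for `‖f z‖ ^ p * exp (-(p / 2) * ‖z‖ ^ 2)` with `f` entire. -/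
theorem Differentiable.gaussian_rpow_mul_measure_ball_le {E : Type*} [NormedAddCommGroup E]
    [InnerProductSpace ℂ E] [SecondCountableTopology E] [MeasurableSpace E] [BorelSpace E]
    {ν : Measure E} [SFinite ν] [ν.IsAddLeftInvariant] [SMulInvariantMeasure Circle E ν]
    {f : E → ℂ} (hf : Differentiable ℂ f) (z : E) {s p : ℝ} (hp : 1 ≤ p)
    (h0 : ν (Metric.ball 0 s) ≠ 0) (htop : ν (Metric.ball 0 s) ≠ ⊤) :
    ENNReal.ofReal (‖f z‖ ^ p * Real.exp (-(p/2) * ‖z‖^2)) * ν (Metric.ball 0 s) ≤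
      ENNReal.ofReal (Real.exp (p/2 * s^2)) *
        ∫⁻ w in Metric.ball z s, ENNReal.ofReal (‖f w‖ ^ p * Real.exp (-(p/2) * ‖w‖^2)) ∂ν := by
  have hc := hf.continuous
  have hp0 : 0 ≤ p := by linarith
  let h : E → ℂ := fun w ↦ f w * Complex.exp ((‖z‖^2/2 : ℝ) - Inner.inner ℂ z w)
  have hh : Differentiable ℂ h := by
    have : Differentiable ℂ fun w : E ↦ Inner.inner ℂ z w := (innerSL ℂ z).differentiable
    fun_prop
  have hnorm : ∀ w, ‖h (z + w)‖ₑ ^ p = ENNReal.ofReal (Real.exp (p/2 * ‖w‖^2)) *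
      ENNReal.ofReal (‖f (z + w)‖ ^ p * Real.exp (-(p/2) * ‖z + w‖^2)) := by
    intro w
    rw [← ofReal_norm, ENNReal.ofReal_rpow_of_nonneg (norm_nonneg _) hp0,
      ← ENNReal.ofReal_mul (Real.exp_pos _).le]
    congr 1
    have hsq := norm_add_sq (𝕜 := ℂ) z w
    have hzz : (Inner.inner ℂ z z).re = ‖z‖^2 := by
      simpa using inner_self_eq_norm_sq (𝕜 := ℂ) z
    simp only [RCLike.re_to_complex] at hsq
    rw [norm_mul, Complex.norm_exp, Complex.sub_re, Complex.ofReal_re, inner_add_right,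
      Complex.add_re, hzz, Real.mul_rpow (norm_nonneg _) (Real.exp_pos _).le, ← Real.exp_mul,
      mul_left_comm, ← Real.exp_add, hsq]
    ring_nf
  have hz : ‖h z‖ₑ ^ p = ENNReal.ofReal (‖f z‖ ^ p * Real.exp (-(p/2) * ‖z‖^2)) := by
    simpa using hnorm 0
  rw [← hz]
  have hhc := hh.continuous
  refine (rpow_mul_measure_le_setLIntegral_rpow h0 htop
    (hhc.comp (continuous_const_add z)).measurable.enorm hp
    (hh.enorm_mul_measure_ball_le_setLIntegral z s)).trans ?_
  have hshift : ∫⁻ w in Metric.ball z s,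
      ENNReal.ofReal (‖f w‖ ^ p * Real.exp (-(p/2) * ‖w‖^2)) ∂ν = ∫⁻ w in Metric.ball 0 s,
      ENNReal.ofReal (‖f (z + w)‖ ^ p * Real.exp (-(p/2) * ‖z + w‖^2)) ∂ν := by
    have := (measurePreserving_add_left ν z).setLIntegral_comp_preimage
      (f := fun w ↦ ENNReal.ofReal (‖f w‖ ^ p * Real.exp (-(p/2) * ‖w‖^2)))
      (Metric.isOpen_ball (x := z) (ε := s)).measurableSet (by fun_prop)
    rw [← this]
    simp
  rw [hshift, ← lintegral_const_mul _ (by fun_prop)]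
  refine setLIntegral_mono' Metric.isOpen_ball.measurableSet fun w hw ↦ ?_
  rw [Function.comp_apply, hnorm w]
  have : ‖w‖ ≤ s := (mem_ball_zero_iff.1 hw).le
  gcongr

/-- The measure-theoretic core of a Carleson embedding: integrating over `z` a bound by integrals
over the balls `ball z r`. -/
theorem lintegral_setLIntegral_ball_le {E : Type*} [PseudoMetricSpace E]
    [SecondCountableTopology E] [MeasurableSpace E] [BorelSpace E] {μ ν : Measure E} [SFinite μ]
    [SFinite ν] {F : E → ENNReal} (hF : Measurable F) (r : ℝ) :
    ∫⁻ z, ∫⁻ w in Metric.ball z r, F w ∂ν ∂μ ≤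
      (⨆ w, μ (Metric.ball w r)) * ∫⁻ w, F w ∂ν := by
  have hD : MeasurableSet {q : E × E | dist q.2 q.1 < r} :=
    (isOpen_lt (by fun_prop) (by fun_prop)).measurableSet
  calc ∫⁻ z, ∫⁻ w in Metric.ball z r, F w ∂ν ∂μ
      = ∫⁻ z, ∫⁻ w, {q : E × E | dist q.2 q.1 < r}.indicator (fun q ↦ F q.2) (z, w) ∂ν ∂μ := by
        refine lintegral_congr fun z ↦ ?_
        rw [← lintegral_indicator Metric.isOpen_ball.measurableSet]
        rfl
    _ = ∫⁻ w, ∫⁻ z, {q : E × E | dist q.2 q.1 < r}.indicator (fun q ↦ F q.2) (z, w) ∂μ ∂ν :=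
        lintegral_lintegral_swap ((hF.comp measurable_snd).indicator hD).aemeasurable
    _ = ∫⁻ w, F w * μ (Metric.ball w r) ∂ν := by
        refine lintegral_congr fun w ↦ ?_
        rw [← lintegral_indicator_const Metric.isOpen_ball.measurableSet]
        refine lintegral_congr fun z ↦ ?_
        simp only [Set.indicator, Set.mem_ofPred_eq, Metric.mem_ball, dist_comm w z]
    _ ≤ ∫⁻ w, (⨆ w, μ (Metric.ball w r)) * F w ∂ν := by
        refine lintegral_mono fun w ↦ ?_
        rw [mul_comm]
        gcongr
        exact le_iSup (fun w ↦ μ (Metric.ball w r)) w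
    _ = _ := lintegral_const_mul _ hF

instance (n : ℕ) : SMulInvariantMeasure Circle (EuclideanSpace ℂ (Fin n)) volume where
  measure_preimage_smul c s hs := by
    let e : EuclideanSpace ℂ (Fin n) ≃ₗᵢ[ℝ] EuclideanSpace ℂ (Fin n) :=
      { DistribMulAction.toLinearEquiv ℝ (EuclideanSpace ℂ (Fin n)) c with
        norm_map' := fun x ↦ by
          change ‖(c : ℂ) • x‖ = ‖x‖
          rw [norm_smul, Circle.norm_coe, one_mul] }
    exact e.measurePreserving.measure_preimage hs.nullMeasurableSet

theorem stmt_14 (n : ℕ) (r p : ℝ) (hr : 0 < r) (hp : 1 ≤ p) :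
    ∃ C > 0, ∀ μ : Measure (EuclideanSpace ℂ (Fin n)),
      (⨆ w : EuclideanSpace ℂ (Fin n), μ (Metric.ball w r)) < ⊤ →
      ∀ f : EuclideanSpace ℂ (Fin n) → ℂ, Differentiable ℂ f →
        (∫⁻ z in {z : EuclideanSpace ℂ (Fin n) | r ≤ ‖z‖},
            ENNReal.ofReal (‖f z‖ ^ p * Real.exp (-(p/2) * ‖z‖^2)) ∂μ) ≤
          ENNReal.ofReal C * (⨆ w : EuclideanSpace ℂ (Fin n), μ (Metric.ball w r)) *
            ∫⁻ w, ENNReal.ofReal (‖f w‖ ^ p * Real.exp (-(p/2) * ‖w‖^2)) := by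
  let V : ENNReal := volume (Metric.ball (0 : EuclideanSpace ℂ (Fin n)) r)
  have h0 : V ≠ 0 := (Metric.measure_ball_pos _ _ hr).ne'
  have htop : V ≠ ⊤ := measure_ball_lt_top.ne
  have hV : 0 < V.toReal := ENNReal.toReal_pos h0 htop
  refine ⟨Real.exp (p/2 * r^2) / V.toReal, by positivity, fun μ hμ f hf ↦ ?_⟩
  have hc := hf.continuous
  have : IsLocallyFiniteMeasure μ := ⟨fun x ↦ ⟨Metric.ball x r, Metric.ball_mem_nhds x hr,
    (le_iSup (fun w ↦ μ (Metric.ball w r)) x).trans_lt hμ⟩⟩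
  let F : EuclideanSpace ℂ (Fin n) → ENNReal :=
    fun z ↦ ENNReal.ofReal (‖f z‖ ^ p * Real.exp (-(p/2) * ‖z‖^2))
  have hF : Measurable F := by fun_prop
  rw [ENNReal.ofReal_div_of_pos hV, ENNReal.ofReal_toReal htop, mul_assoc,
    ENNReal.mul_comm_div, ← mul_div_assoc, ENNReal.le_div_iff_mul_le (.inl h0) (.inl htop)]
  calc (∫⁻ z in {z | r ≤ ‖z‖}, F z ∂μ) * V
      ≤ (∫⁻ z, F z ∂μ) * V := by
        gcongr
        exact Measure.restrict_le_self
    _ = ∫⁻ z, F z * V ∂μ := (lintegral_mul_const _ hF).symm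
    _ ≤ ∫⁻ z, ENNReal.ofReal (Real.exp (p/2 * r^2)) * ∫⁻ w in Metric.ball z r, F w ∂volume ∂μ :=
        lintegral_mono fun z ↦ hf.gaussian_rpow_mul_measure_ball_le z hp h0 htop
    _ = ENNReal.ofReal (Real.exp (p/2 * r^2)) * ∫⁻ z, ∫⁻ w in Metric.ball z r, F w ∂volume ∂μ :=
        lintegral_const_mul' _ _ ENNReal.ofReal_ne_top
    _ ≤ _ := by
        gcongr
        exact lintegral_setLIntegral_ball_le hF r
end
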